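/- Let Λ be an artin algebra and let M[1] → M[2] → M[3] → ⋯ be a chain of irreducible monomorphisms between indecomposable finite length Λ-modules such that M[m]/M[m−1] ≅ M[1] for all m ≥ 2 and M[m]/M[m−2] is indecomposable for all m ≥ 2 (with M[0] = 0), and assume M[1] is a brick (this is the situation of a homogeneous tube of the Auslander-Reiten quiver whose boundary module M[1] is a brick). Let M[∞] be the direct limit of this chain (the associated Prüfer module), and define the Gabriel-Roiter measure of M[∞] as the supremum of the measures μ(U) over all finite length submodules U of M[∞]. Then this Gabriel-Roiter measure is a rational number; explicitly, it equals μ(X) + 1/(2^s − 1), where X is a Gabriel-Roiter submodule of M[1] and s = |M[1]|. -/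

import Mathlib

/-!
Setting: `k` is a commutative artinian ring and `Λ` an artin `k`-algebra
(an algebra over `k` which is finitely generated as a `k`-module).
All modules considered are `Λ`-modules of finite length (`IsFiniteLength Λ M`),
and `|M|` denotes the length of `M`, implemented as the height
`Order.height (⊤ : Submodule Λ M)` of the lattice of submodules
(for a submodule `N` of an ambient module, its length is `Order.height N`).
-/

universe u v

open Submodule

section GRDefs

variable (Λ : Type u) [Ring Λ]

/-- A submodule `N` of an ambient module is indecomposable (as a module):
it is nonzero, and whenever it is the direct sum of two submodules, one of them is zero. -/
def IndecSub {Y : Type v} [AddCommGroup Y] [Module Λ Y] (N : Submodule Λ Y) : Prop :=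
  N ≠ ⊥ ∧ ∀ A B : Submodule Λ Y, A ≤ N → B ≤ N → A ⊔ B = N → A ⊓ B = ⊥ → A = ⊥ ∨ B = ⊥

/-- A module is indecomposable iff its top submodule is. -/
def IndecMod (M : Type v) [AddCommGroup M] [Module Λ M] : Prop :=
  IndecSub Λ (⊤ : Submodule Λ M)

/-- The length `|M|` of a module, as an extended natural number. -/
noncomputable def modLen (M : Type v) [AddCommGroup M] [Module Λ M] : ℕ∞ :=
  Order.height (⊤ : Submodule Λ M)

/-- The length `|N|` of a submodule of an ambient module, as a natural number. -/
noncomputable def subLen {Y : Type v} [AddCommGroup Y] [Module Λ Y] (N : Submodule Λ Y) : ℕ :=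
  (Order.height N).toNat

open Classical in
/-- Fuel-based auxiliary function for the Gabriel-Roiter measure. -/
noncomputable def muAux {Y : Type v} [AddCommGroup Y] [Module Λ Y] :
    ℕ → Submodule Λ Y → ℝ
  | 0, _ => 0
  | n + 1, N =>
      (if IndecSub Λ N then (2 : ℝ) ^ (-(subLen Λ N : ℤ)) else 0)
        + sSup (muAux n '' {N' : Submodule Λ Y | N' < N})

/-- The Gabriel-Roiter measure `μ(N)` of a submodule `N` of an ambient module:
`μ(0) = 0`; if `N ≠ 0` is decomposable, `μ(N)` is the maximum of `μ(N')` over proper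
submodules `N'` of `N`; if `N` is indecomposable, `μ(N) = 2^(-|N|)` plus this maximum.
(For modules of finite length the supremum is a maximum and the fuel `|N|` suffices for
the recursion, so this agrees with the usual inductive definition; the measure of a
submodule depends only on the sublattice of its submodules, hence it does not matter
in which ambient module it is computed.) -/
noncomputable def mu {Y : Type v} [AddCommGroup Y] [Module Λ Y] (N : Submodule Λ Y) : ℝ :=
  muAux Λ (subLen Λ N) N

/-- The Gabriel-Roiter measure of a module. -/
noncomputable def muMod (M : Type v) [AddCommGroup M] [Module Λ M] : ℝ :=
  mu Λ (⊤ : Submodule Λ M)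

/-- `X` is a Gabriel-Roiter submodule of the (indecomposable, non-simple) ambient
module `Y`: `X` is an indecomposable proper submodule with `μ(Y) = μ(X) + 2^(-|Y|)`. -/
def IsGRSub {Y : Type v} [AddCommGroup Y] [Module Λ Y] (X : Submodule Λ Y) : Prop :=
  IndecMod Λ Y ∧ IndecSub Λ X ∧ X ≠ ⊤ ∧
    mu Λ (⊤ : Submodule Λ Y) = mu Λ X + (2 : ℝ) ^ (-(subLen Λ (⊤ : Submodule Λ Y) : ℤ))

/-- A map `u : X → Y` is a Gabriel-Roiter inclusion iff it is injective and its
image is a Gabriel-Roiter submodule of `Y`. -/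
def IsGRInclusion {X Y : Type v} [AddCommGroup X] [Module Λ X] [AddCommGroup Y] [Module Λ Y]
    (u : X →ₗ[Λ] Y) : Prop :=
  Function.Injective u ∧ IsGRSub Λ (LinearMap.range u)

/-- A linear map is a split monomorphism. -/
def IsSplitMonoHom {A B : Type v} [AddCommGroup A] [Module Λ A] [AddCommGroup B] [Module Λ B]
    (f : A →ₗ[Λ] B) : Prop :=
  ∃ g : B →ₗ[Λ] A, g.comp f = LinearMap.id

/-- A linear map is a split epimorphism. -/
def IsSplitEpiHom {A B : Type v} [AddCommGroup A] [Module Λ A] [AddCommGroup B] [Module Λ B]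
    (f : A →ₗ[Λ] B) : Prop :=
  ∃ g : B →ₗ[Λ] A, f.comp g = LinearMap.id

/-- A morphism `f` in the category of finite length `Λ`-modules is irreducible if it is
neither a split monomorphism nor a split epimorphism and, whenever `f = g ∘ h` with the
intermediate module of finite length, either `h` is a split monomorphism or `g` is a
split epimorphism. -/
def IsIrreducibleHom {A B : Type v} [AddCommGroup A] [Module Λ A] [AddCommGroup B] [Module Λ B]
    (f : A →ₗ[Λ] B) : Prop :=
  ¬ IsSplitMonoHom Λ f ∧ ¬ IsSplitEpiHom Λ f ∧
    ∀ (Z : Type v) [AddCommGroup Z] [Module Λ Z], IsFiniteLength Λ Z →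
      ∀ (h : A →ₗ[Λ] Z) (g : Z →ₗ[Λ] B), f = g.comp h →
        IsSplitMonoHom Λ h ∨ IsSplitEpiHom Λ g

/-- An indecomposable submodule `U` of the ambient module is piling provided
`μ(V) ≤ μ(U)` for every indecomposable submodule `V` with `|V| ≤ |U|`. -/
def IsPilingSub {Y : Type v} [AddCommGroup Y] [Module Λ Y] (U : Submodule Λ Y) : Prop :=
  IndecSub Λ U ∧ ∀ V : Submodule Λ Y, IndecSub Λ V →
    Order.height V ≤ Order.height U → mu Λ V ≤ mu Λ U

/-- A Gabriel-Roiter filtration `c 0 ⊂ c 1 ⊂ ⋯ ⊂ c t = N` of an (indecomposable)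
submodule `N`: a chain of indecomposable submodules starting at a simple module such
that each inclusion `c i ⊂ c (i+1)` is a Gabriel-Roiter inclusion,
i.e. `μ(c (i+1)) = μ(c i) + 2^(-|c (i+1)|)`. -/
def IsGRFiltration {Y : Type v} [AddCommGroup Y] [Module Λ Y] {t : ℕ}
    (c : Fin (t + 1) → Submodule Λ Y) (N : Submodule Λ Y) : Prop :=
  c (Fin.last t) = N ∧
  IsSimpleModule Λ (c 0) ∧
  (∀ i : Fin (t + 1), IndecSub Λ (c i)) ∧
  ∀ i : Fin t, c i.castSucc < c i.succ ∧
    mu Λ (c i.succ) = mu Λ (c i.castSucc) + (2 : ℝ) ^ (-(subLen Λ (c i.succ) : ℤ))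

/-- A brick: a nonzero module all of whose nonzero endomorphisms are invertible
(i.e. the endomorphism ring is a division ring). -/
def IsBrick (M : Type v) [AddCommGroup M] [Module Λ M] : Prop :=
  (∃ x : M, x ≠ 0) ∧ ∀ f : M →ₗ[Λ] M, f ≠ 0 → Function.Bijective f

/-- An `M`-filtration `0 = c 0 ⊂ c 1 ⊂ ⋯ ⊂ c m = Y` of the module `Y`
(so `c j` is the module `M[j]`, with `M[0] = 0`, and the `M`-length of `Y` is `m`):
all consecutive factors `c (i+1) / c i` are isomorphic to `M`. -/
structure IsMFiltration (M : Type v) [AddCommGroup M] [Module Λ M]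
    {Y : Type v} [AddCommGroup Y] [Module Λ Y] {m : ℕ}
    (c : Fin (m + 1) → Submodule Λ Y) : Prop where
  bot : c 0 = ⊥
  top : c (Fin.last m) = ⊤
  lt : ∀ i : Fin m, c i.castSucc < c i.succ
  quot : ∀ i : Fin m,
    Nonempty ((↥(c i.succ) ⧸ comap (c i.succ).subtype (c i.castSucc)) ≃ₗ[Λ] M)

/-- A homogeneous `M`-filtration: an `M`-filtration in which moreover all the
`M[i] = c i` with `i ≥ 1` are indecomposable and all the inclusions
`M[i-1] ⊂ M[i]` for `2 ≤ i ≤ m` are irreducible monomorphisms. -/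
structure IsHomogMFiltration (M : Type v) [AddCommGroup M] [Module Λ M]
    {Y : Type v} [AddCommGroup Y] [Module Λ Y] {m : ℕ}
    (c : Fin (m + 1) → Submodule Λ Y) extends IsMFiltration Λ M c : Prop where
  indec : ∀ i : Fin (m + 1), i ≠ 0 → IndecSub Λ (c i)
  irr : ∀ i : Fin m, (i : ℕ) ≠ 0 →
    IsIrreducibleHom Λ (Submodule.inclusion (toIsMFiltration.lt i).le)

end GRDefs

namespace GabrielRoiter

section Length

variable {Λ : Type u} [Ring Λ] {Y : Type v} [AddCommGroup Y] [Module Λ Y]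
  {A : Type v} [AddCommGroup A] [Module Λ A]

lemma isFiniteLength_of_le {N K : Submodule Λ Y} (h : K ≤ N) (hN : IsFiniteLength Λ N) :
    IsFiniteLength Λ K :=
  hN.of_injective (Submodule.inclusion_injective h)

lemma isFiniteLength_map (f : Y →ₗ[Λ] A) {N : Submodule Λ Y} (hN : IsFiniteLength Λ N) :
    IsFiniteLength Λ (map f N) :=
  hN.of_surjective (f.submoduleMap_surjective N)

lemma coe_subLen {N : Submodule Λ Y} (hN : IsFiniteLength Λ N) :
    (subLen Λ N : ℕ∞) = Module.length Λ N := by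
  rw [Module.length_submodule, subLen, ENat.natCast_toNat]
  rw [← Module.length_submodule]
  exact Module.length_ne_top_iff.mpr hN

lemma subLen_congr {N : Submodule Λ Y} {N' : Submodule Λ A} (e : N ≃ₗ[Λ] N') :
    subLen Λ N = subLen Λ N' := by
  rw [subLen, subLen, ← Module.length_submodule, ← Module.length_submodule, e.length_eq]

lemma subLen_bot : subLen Λ (⊥ : Submodule Λ Y) = 0 := by
  simp [subLen]

lemma subLen_lt {N K : Submodule Λ Y} (h : K < N) (hN : IsFiniteLength Λ N) :
    subLen Λ K < subLen Λ N := by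
  have hK := isFiniteLength_of_le h.le hN
  have := Order.height_strictMono h (by
    rw [← Module.length_submodule]
    exact lt_top_iff_ne_top.mpr (Module.length_ne_top_iff.mpr hK))
  rw [← Module.length_submodule, ← Module.length_submodule, ← coe_subLen hK,
    ← coe_subLen hN] at this
  exact_mod_cast this

lemma subLen_mono {N K : Submodule Λ Y} (h : K ≤ N) (hN : IsFiniteLength Λ N) :
    subLen Λ K ≤ subLen Λ N := by
  rcases h.eq_or_lt with rfl | h
  · exact le_rfl
  · exact (subLen_lt h hN).le

lemma eq_of_subLen_le {N K : Submodule Λ Y} (h : K ≤ N) (hN : IsFiniteLength Λ N)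
    (hl : subLen Λ N ≤ subLen Λ K) : K = N := by
  rcases h.eq_or_lt with h | h
  · exact h
  · exact absurd (subLen_lt h hN) (by omega)

lemma subLen_eq_inf_ker_add_map (f : Y →ₗ[Λ] A) {N : Submodule Λ Y} (hN : IsFiniteLength Λ N) :
    subLen Λ N = subLen Λ (N ⊓ LinearMap.ker f) + subLen Λ (map f N) := by
  have h := Module.length_eq_add_of_exact
    (Submodule.inclusion (inf_le_left : N ⊓ LinearMap.ker f ≤ N)) (f.submoduleMap N)
    (Submodule.inclusion_injective _) (f.submoduleMap_surjective N) (by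
      intro x
      constructor
      · intro hx
        exact ⟨⟨x, x.2, by simpa [Subtype.ext_iff] using hx⟩, rfl⟩
      · rintro ⟨y, rfl⟩
        exact Subtype.ext y.2.2)
  rw [← coe_subLen hN, ← coe_subLen (isFiniteLength_of_le inf_le_left hN),
    ← coe_subLen (isFiniteLength_map f hN)] at h
  exact_mod_cast h

/-- The restriction of `f` to a submodule meeting its kernel trivially. -/
noncomputable def equivMap (f : Y →ₗ[Λ] A) {N : Submodule Λ Y} (h : N ⊓ LinearMap.ker f = ⊥) :
    N ≃ₗ[Λ] map f N :=
  LinearEquiv.ofBijective (f.submoduleMap N) ⟨by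
    rw [injective_iff_map_eq_zero]
    intro x hx
    have hx' : (x : Y) ∈ N ⊓ LinearMap.ker f := ⟨x.2, by simpa [Subtype.ext_iff] using hx⟩
    rw [h] at hx'
    exact Subtype.ext hx', f.submoduleMap_surjective N⟩

lemma map_le_map_iff_of_inf_ker {f : Y →ₗ[Λ] A} {N : Submodule Λ Y}
    (h : N ⊓ LinearMap.ker f = ⊥) {P Q : Submodule Λ Y} (hP : P ≤ N) (hQ : Q ≤ N) :
    map f P ≤ map f Q ↔ P ≤ Q := by
  refine ⟨fun hPQ x hx => ?_, map_mono⟩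
  obtain ⟨y, hy, hxy⟩ := hPQ (mem_map_of_mem hx)
  have : y - x ∈ N ⊓ LinearMap.ker f :=
    ⟨N.sub_mem (hQ hy) (hP hx), by simp [hxy]⟩
  rw [h, mem_bot, sub_eq_zero] at this
  exact this ▸ hy

lemma exists_eq_map_of_le_map {f : Y →ₗ[Λ] A} {N : Submodule Λ Y} {P : Submodule Λ A}
    (hP : P ≤ map f N) : ∃ Q ≤ N, map f Q = P := by
  refine ⟨N ⊓ comap f P, inf_le_left, le_antisymm ?_ ?_⟩
  · rintro _ ⟨x, hx, rfl⟩
    exact hx.2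
  · intro y hy
    obtain ⟨x, hx, rfl⟩ := hP hy
    exact ⟨x, ⟨hx, hy⟩, rfl⟩

lemma map_inf_of_inf_ker {f : Y →ₗ[Λ] A} {N : Submodule Λ Y}
    (h : N ⊓ LinearMap.ker f = ⊥) {P Q : Submodule Λ Y} (hP : P ≤ N) (hQ : Q ≤ N) :
    map f (P ⊓ Q) = map f P ⊓ map f Q := by
  refine le_antisymm (le_inf (map_mono inf_le_left) (map_mono inf_le_right)) ?_
  obtain ⟨R, hR, hRe⟩ := exists_eq_map_of_le_map
    (show map f P ⊓ map f Q ≤ map f N from inf_le_left.trans (map_mono hP))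
  rw [← hRe]
  refine map_mono (le_inf ?_ ?_)
  · exact (map_le_map_iff_of_inf_ker h hR hP).mp (hRe.le.trans inf_le_left)
  · exact (map_le_map_iff_of_inf_ker h hR hQ).mp (hRe.le.trans inf_le_right)

lemma map_eq_bot_iff_of_inf_ker {f : Y →ₗ[Λ] A} {N : Submodule Λ Y}
    (h : N ⊓ LinearMap.ker f = ⊥) {P : Submodule Λ Y} (hP : P ≤ N) :
    map f P = ⊥ ↔ P = ⊥ := by
  rw [← le_bot_iff, ← le_bot_iff, ← map_le_map_iff_of_inf_ker h hP bot_le, Submodule.map_bot]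

lemma indecSub_map_iff {f : Y →ₗ[Λ] A} {N : Submodule Λ Y}
    (h : N ⊓ LinearMap.ker f = ⊥) : IndecSub Λ (map f N) ↔ IndecSub Λ N := by
  have inj : ∀ {P Q : Submodule Λ Y}, P ≤ N → Q ≤ N → map f P = map f Q → P = Q :=
    fun hP hQ he => le_antisymm ((map_le_map_iff_of_inf_ker h hP hQ).mp he.le)
      ((map_le_map_iff_of_inf_ker h hQ hP).mp he.ge)
  refine and_congr (map_eq_bot_iff_of_inf_ker h le_rfl).not ⟨fun H P Q hP hQ hs hi => ?_,
    fun H P Q hP hQ hs hi => ?_⟩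
  · rw [← map_eq_bot_iff_of_inf_ker h hP, ← map_eq_bot_iff_of_inf_ker h hQ]
    refine H _ _ (map_mono hP) (map_mono hQ) ?_ ?_
    · rw [← Submodule.map_sup, hs]
    · rw [← map_inf_of_inf_ker h hP hQ, hi, Submodule.map_bot]
  · obtain ⟨P, hPN, rfl⟩ := exists_eq_map_of_le_map hP
    obtain ⟨Q, hQN, rfl⟩ := exists_eq_map_of_le_map hQ
    rw [map_eq_bot_iff_of_inf_ker h hPN, map_eq_bot_iff_of_inf_ker h hQN]
    refine H _ _ hPN hQN (inj (sup_le hPN hQN) le_rfl ?_) ?_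
    · rw [Submodule.map_sup, hs]
    · rw [← map_eq_bot_iff_of_inf_ker h (inf_le_left.trans hPN),
        map_inf_of_inf_ker h hPN hQN, hi]

lemma not_indecSub_bot : ¬ IndecSub Λ (⊥ : Submodule Λ Y) := fun h => h.1 rfl

lemma exists_decomposition {N : Submodule Λ Y} (h0 : N ≠ ⊥) (hi : ¬ IndecSub Λ N) :
    ∃ P Q : Submodule Λ Y, P < N ∧ Q < N ∧ P ⊔ Q = N ∧ P ⊓ Q = ⊥ := by
  obtain ⟨P, Q, hP, hQ, hs, hpq, hP0, hQ0⟩ : ∃ P Q : Submodule Λ Y, P ≤ N ∧ Q ≤ N ∧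
      P ⊔ Q = N ∧ P ⊓ Q = ⊥ ∧ P ≠ ⊥ ∧ Q ≠ ⊥ := by
    simpa [IndecSub, h0] using hi
  refine ⟨P, Q, lt_of_le_of_ne hP fun e => hQ0 ?_, lt_of_le_of_ne hQ fun e => hP0 ?_, hs, hpq⟩
  · rw [← hpq, e, inf_eq_right.mpr hQ]
  · rw [← hpq, e, inf_eq_left.mpr hP]

end Length

section Measure

variable {Λ : Type u} [Ring Λ] {Y : Type v} [AddCommGroup Y] [Module Λ Y]
  {A : Type v} [AddCommGroup A] [Module Λ A]

lemma muAux_map {f : Y →ₗ[Λ] A} (n : ℕ) {N : Submodule Λ Y}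
    (h : N ⊓ LinearMap.ker f = ⊥) : muAux Λ n (map f N) = muAux Λ n N := by
  induction n generalizing N with
  | zero => rfl
  | succ n ih =>
    have himg : muAux Λ n '' {N' | N' < map f N} = muAux Λ n '' {N' | N' < N} := by
      ext r
      constructor
      · rintro ⟨P, hP, rfl⟩
        obtain ⟨Q, hQ, rfl⟩ := exists_eq_map_of_le_map (le_of_lt hP)
        refine ⟨Q, lt_of_le_of_ne hQ fun e => ?_, ?_⟩
        · exact absurd hP (by simp [e])
        · exact (ih (le_bot_iff.mp ((inf_le_inf_right _ hQ).trans h.le))).symm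
      · rintro ⟨Q, hQ, rfl⟩
        refine ⟨map f Q, lt_of_le_not_ge (map_mono (le_of_lt hQ)) fun e => ?_, ?_⟩
        · exact not_le_of_gt hQ ((map_le_map_iff_of_inf_ker h le_rfl (le_of_lt hQ)).mp e)
        · exact ih (le_bot_iff.mp ((inf_le_inf_right _ (le_of_lt hQ)).trans h.le))
    simp only [muAux, himg, ← subLen_congr (equivMap f h)]
    by_cases hi : IndecSub Λ N
    · rw [if_pos hi, if_pos ((indecSub_map_iff h).mpr hi)]
    · rw [if_neg hi, if_neg ((indecSub_map_iff h).not.mpr hi)]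

lemma mu_map {f : Y →ₗ[Λ] A} {N : Submodule Λ Y} (h : N ⊓ LinearMap.ker f = ⊥) :
    mu Λ (map f N) = mu Λ N := by
  rw [mu, mu, muAux_map _ h, ← subLen_congr (equivMap f h)]

lemma mu_congr {N : Submodule Λ Y} {N' : Submodule Λ A} (e : N ≃ₗ[Λ] N') :
    mu Λ N = mu Λ N' := by
  have h1 := mu_map (f := N.subtype) (N := ⊤) (by simp)
  have h2 := mu_map (f := N'.subtype.comp e.toLinearMap) (N := ⊤) (by
    rw [LinearMap.ker_eq_bot.mpr]
    · simp
    · exact N'.injective_subtype.comp e.injective)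
  rw [Submodule.map_top, range_subtype] at h1
  rw [Submodule.map_top, LinearMap.range_comp_of_range_eq_top _ e.range, range_subtype] at h2
  rw [h1, h2]

lemma indecSub_congr {N : Submodule Λ Y} {N' : Submodule Λ A} (e : N ≃ₗ[Λ] N') :
    IndecSub Λ N ↔ IndecSub Λ N' := by
  have h1 := indecSub_map_iff (f := N.subtype) (N := ⊤) (by simp)
  have h2 := indecSub_map_iff (f := N'.subtype.comp e.toLinearMap) (N := ⊤) (by
    rw [LinearMap.ker_eq_bot.mpr]
    · simp
    · exact N'.injective_subtype.comp e.injective)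
  rw [Submodule.map_top, range_subtype] at h1
  rw [Submodule.map_top, LinearMap.range_comp_of_range_eq_top _ e.range, range_subtype] at h2
  rw [h1, h2]

lemma muAux_eq_mu (n : ℕ) {N : Submodule Λ Y} (hN : IsFiniteLength Λ N)
    (hn : subLen Λ N ≤ n) : muAux Λ n N = mu Λ N := by
  suffices H : ∀ n m : ℕ, ∀ N : Submodule Λ Y, IsFiniteLength Λ N → subLen Λ N ≤ n →
      subLen Λ N ≤ m → muAux Λ n N = muAux Λ m N from H _ _ N hN hn le_rfl
  have hz : ∀ n : ℕ, ∀ N : Submodule Λ Y, IsFiniteLength Λ N → subLen Λ N = 0 →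
      muAux Λ n N = 0 := by
    intro n N hN h0
    obtain rfl : ⊥ = N := eq_of_subLen_le bot_le hN (by omega)
    cases n with
    | zero => rfl
    | succ n => simp [muAux, not_indecSub_bot]
  intro n
  induction n with
  | zero =>
    intro m N hN h _
    rw [hz _ N hN (by omega), hz _ N hN (by omega)]
  | succ n ih =>
    intro m N hN h h'
    cases m with
    | zero => rw [hz _ N hN (by omega), hz _ N hN (by omega)]
    | succ m =>
      have : muAux Λ n '' {N' | N' < N} = muAux Λ m '' {N' | N' < N} :=
        Set.image_congr fun P hP => ih m P (isFiniteLength_of_le (le_of_lt hP) hN)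
          (by have := subLen_lt hP hN; omega) (by have := subLen_lt hP hN; omega)
      simp only [muAux, this]

open Classical in
lemma mu_eq {N : Submodule Λ Y} (hN : IsFiniteLength Λ N) :
    mu Λ N = (if IndecSub Λ N then (2 : ℝ) ^ (-(subLen Λ N : ℤ)) else 0)
      + sSup (mu Λ '' {N' | N' < N}) := by
  rw [← muAux_eq_mu (subLen Λ N + 1) hN (by omega), muAux]
  congr 2
  exact Set.image_congr fun P hP => muAux_eq_mu _ (isFiniteLength_of_le (le_of_lt hP) hN)
    (subLen_lt hP hN).le

lemma mu_bot : mu Λ (⊥ : Submodule Λ Y) = 0 := by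
  rw [mu, subLen_bot, muAux]

lemma exists_dyadic_of_le {r : ℝ} {m n : ℕ} (hmn : m ≤ n)
    (hr : ∃ z : ℕ, z < 2 ^ m ∧ r = z / 2 ^ m) : ∃ z : ℕ, z < 2 ^ n ∧ r = z / 2 ^ n := by
  obtain ⟨z, hz, rfl⟩ := hr
  obtain ⟨d, rfl⟩ := Nat.exists_eq_add_of_le hmn
  refine ⟨z * 2 ^ d, ?_, ?_⟩
  · rw [pow_add]
    exact Nat.mul_lt_mul_of_pos_right hz (by positivity)
  · rw [pow_add]
    push_cast
    field_simp

lemma finite_of_forall_dyadic {S : Set ℝ} {n : ℕ}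
    (hS : ∀ r ∈ S, ∃ z : ℕ, z < 2 ^ n ∧ r = z / 2 ^ n) : S.Finite := by
  refine ((Finset.range (2 ^ n)).image (fun z : ℕ => (z : ℝ) / 2 ^ n)).finite_toSet.subset ?_
  intro r hr
  obtain ⟨z, hz, rfl⟩ := hS r hr
  simp only [Finset.coe_image, Set.mem_image, Finset.coe_range, Set.mem_Iio]
  exact ⟨z, hz, rfl⟩

/-- The measure of a module of length `n` is a rational number in `[0, 1)` with
denominator dividing `2 ^ n`. -/
lemma exists_mu_eq {N : Submodule Λ Y} (hN : IsFiniteLength Λ N) :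
    ∃ z : ℕ, z < 2 ^ subLen Λ N ∧ mu Λ N = z / 2 ^ subLen Λ N := by
  induction hn : subLen Λ N using Nat.strong_induction_on generalizing N with
  | _ n ih =>
  subst hn
  by_cases h0 : N = ⊥
  · subst h0
    exact ⟨0, by positivity, by simp [mu_bot]⟩
  have hpos : 0 < subLen Λ N := by
    simpa [subLen_bot] using subLen_lt (bot_lt_iff_ne_bot.mpr h0) hN
  obtain ⟨n, hn⟩ : ∃ n, subLen Λ N = n + 1 := ⟨_, (Nat.succ_pred_eq_of_pos hpos).symm⟩
  have hsub : ∀ r ∈ mu Λ '' {N' | N' < N}, ∃ z : ℕ, z < 2 ^ n ∧ r = z / 2 ^ n := by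
    rintro _ ⟨P, hP, rfl⟩
    have hlt := subLen_lt hP hN
    exact exists_dyadic_of_le (by omega)
      (ih _ hlt (isFiniteLength_of_le (le_of_lt hP) hN) rfl)
  have hne : (mu Λ '' {N' | N' < N}).Nonempty := ⟨_, ⊥, bot_lt_iff_ne_bot.mpr h0, rfl⟩
  obtain ⟨z, hz, he⟩ := hsub _ (hne.csSup_mem (finite_of_forall_dyadic hsub))
  rw [mu_eq hN, he, hn]
  have hz' : z + 1 ≤ 2 ^ n := hz
  split_ifs
  · refine ⟨2 * z + 1, by rw [pow_succ]; omega, ?_⟩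
    rw [zpow_neg, zpow_natCast, pow_succ]
    push_cast
    field_simp
    ring
  · refine ⟨2 * z, by rw [pow_succ]; omega, ?_⟩
    rw [pow_succ]
    push_cast
    field_simp
    ring

lemma finite_mu_image {N : Submodule Λ Y} (hN : IsFiniteLength Λ N) :
    (mu Λ '' {N' | N' < N}).Finite := by
  refine finite_of_forall_dyadic (n := subLen Λ N) ?_
  rintro _ ⟨P, hP, rfl⟩
  exact exists_dyadic_of_le (subLen_lt hP hN).le
    (exists_mu_eq (isFiniteLength_of_le (le_of_lt hP) hN))

lemma mu_nonneg {N : Submodule Λ Y} (hN : IsFiniteLength Λ N) : 0 ≤ mu Λ N := by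
  obtain ⟨z, -, he⟩ := exists_mu_eq hN
  rw [he]
  positivity

lemma mu_add_le_of_lt {N K : Submodule Λ Y} (h : K < N) (hN : IsFiniteLength Λ N)
    (hi : IndecSub Λ N) : mu Λ K + (2 : ℝ) ^ (-(subLen Λ N : ℤ)) ≤ mu Λ N := by
  rw [mu_eq hN, if_pos hi, add_comm]
  gcongr
  exact le_csSup (finite_mu_image hN).bddAbove ⟨K, h, rfl⟩

lemma mu_lt_of_lt {N K : Submodule Λ Y} (h : K < N) (hN : IsFiniteLength Λ N)
    (hi : IndecSub Λ N) : mu Λ K < mu Λ N := by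
  have := mu_add_le_of_lt h hN hi
  have : (0 : ℝ) < (2 : ℝ) ^ (-(subLen Λ N : ℤ)) := by positivity
  linarith

lemma mu_mono {N K : Submodule Λ Y} (h : K ≤ N) (hN : IsFiniteLength Λ N) :
    mu Λ K ≤ mu Λ N := by
  rcases h.eq_or_lt with rfl | h
  · exact le_rfl
  rw [mu_eq hN]
  have := le_csSup (finite_mu_image hN).bddAbove ⟨K, h, rfl⟩
  split_ifs
  · have : (0 : ℝ) < (2 : ℝ) ^ (-(subLen Λ N : ℤ)) := by positivity
    linarith
  · linarith

lemma exists_lt_sSup_eq {N : Submodule Λ Y} (hN : IsFiniteLength Λ N) (h0 : N ≠ ⊥) :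
    ∃ K < N, sSup (mu Λ '' {N' | N' < N}) = mu Λ K := by
  have hne : (mu Λ '' {N' | N' < N}).Nonempty := ⟨_, ⊥, bot_lt_iff_ne_bot.mpr h0, rfl⟩
  obtain ⟨K, hK, he⟩ := hne.csSup_mem (finite_mu_image hN)
  exact ⟨K, hK, he.symm⟩

/-- The measure of a nonzero module is attained on an indecomposable submodule. -/
lemma exists_indecSub_mu_eq {N : Submodule Λ Y} (hN : IsFiniteLength Λ N) (h0 : N ≠ ⊥) :
    ∃ U ≤ N, IndecSub Λ U ∧ mu Λ U = mu Λ N := by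
  induction hn : subLen Λ N using Nat.strong_induction_on generalizing N with
  | _ n ih =>
  subst hn
  by_cases hi : IndecSub Λ N
  · exact ⟨N, le_rfl, hi, rfl⟩
  obtain ⟨K, hK, he⟩ := exists_lt_sSup_eq hN h0
  have hmu : mu Λ N = mu Λ K := by rw [mu_eq hN, if_neg hi, he, zero_add]
  by_cases hK0 : K = ⊥
  · exfalso
    obtain ⟨P, Q, hP, hQ, hs, -⟩ := exists_decomposition h0 hi
    have hP0 : P ≠ ⊥ := fun h => hQ.ne (by rw [← hs, h, bot_sup_eq])
    obtain ⟨U, hU, hUi, hUe⟩ := ih _ (subLen_lt hP hN) (isFiniteLength_of_le hP.le hN) hP0 rfl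
    have h1 := mu_lt_of_lt (bot_lt_iff_ne_bot.mpr hUi.1)
      (isFiniteLength_of_le (hU.trans hP.le) hN) hUi
    have h2 := mu_mono hP.le hN
    rw [hmu, hK0] at h2
    linarith
  obtain ⟨U, hU, hUi, hUe⟩ := ih _ (subLen_lt hK hN) (isFiniteLength_of_le hK.le hN) hK0 rfl
  exact ⟨U, hU.trans hK.le, hUi, hUe.trans hmu.symm⟩

lemma mu_pos {N : Submodule Λ Y} (hN : IsFiniteLength Λ N) (h0 : N ≠ ⊥) : 0 < mu Λ N := by
  obtain ⟨U, hU, hUi, hUe⟩ := exists_indecSub_mu_eq hN h0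
  rw [← hUe, ← mu_bot (Λ := Λ) (Y := Y)]
  exact mu_lt_of_lt (bot_lt_iff_ne_bot.mpr hUi.1) (isFiniteLength_of_le hU hN) hUi

lemma mu_le_of_forall_indecSub {N : Submodule Λ Y} (hN : IsFiniteLength Λ N) {c : ℝ}
    (hc : 0 ≤ c) (h : ∀ U ≤ N, IndecSub Λ U → mu Λ U ≤ c) : mu Λ N ≤ c := by
  by_cases h0 : N = ⊥
  · rwa [h0, mu_bot]
  obtain ⟨U, hU, hUi, hUe⟩ := exists_indecSub_mu_eq hN h0
  exact hUe ▸ h U hU hUi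

/-- Every indecomposable module is either simple or has a Gabriel-Roiter submodule. -/
lemma exists_gr_sub {N : Submodule Λ Y} (hN : IsFiniteLength Λ N) (hi : IndecSub Λ N) :
    ∃ K < N, (K = ⊥ ∨ IndecSub Λ K) ∧
      mu Λ N = mu Λ K + (2 : ℝ) ^ (-(subLen Λ N : ℤ)) := by
  obtain ⟨K, hK, he⟩ := exists_lt_sSup_eq hN hi.1
  have hmu : mu Λ N = mu Λ K + (2 : ℝ) ^ (-(subLen Λ N : ℤ)) := by
    rw [mu_eq hN, if_pos hi, he, add_comm]
  by_cases hK0 : K = ⊥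
  · exact ⟨K, hK, Or.inl hK0, hmu⟩
  obtain ⟨U, hU, hUi, hUe⟩ := exists_indecSub_mu_eq (isFiniteLength_of_le hK.le hN) hK0
  exact ⟨U, hU.trans_lt hK, Or.inr hUi, by rw [hmu, hUe]⟩

/-- Adding one digit beyond the lengths involved does not overtake a larger measure. -/
lemma mu_add_lt {N : Submodule Λ Y} {K : Submodule Λ A} (hN : IsFiniteLength Λ N)
    (hK : IsFiniteLength Λ K) (h : mu Λ N < mu Λ K) {n : ℕ} (hNn : subLen Λ N < n)
    (hKn : subLen Λ K < n) : mu Λ N + (2 : ℝ) ^ (-(n : ℤ)) < mu Λ K := by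
  obtain ⟨m, rfl⟩ : ∃ m, n = m + 1 := ⟨n - 1, by omega⟩
  obtain ⟨a, -, ha⟩ := exists_dyadic_of_le (Nat.lt_succ_iff.mp hNn) (exists_mu_eq hN)
  obtain ⟨b, -, hb⟩ := exists_dyadic_of_le (Nat.lt_succ_iff.mp hKn) (exists_mu_eq hK)
  rw [ha, hb] at h ⊢
  have hab : a < b := by
    rw [div_lt_div_iff_of_pos_right (by positivity)] at h
    exact_mod_cast h
  have hab' : (a : ℝ) + 1 ≤ b := by exact_mod_cast hab
  rw [zpow_neg, zpow_natCast, pow_succ]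
  have : (0 : ℝ) < 2 ^ m := by positivity
  rw [lt_div_iff₀ this]
  field_simp
  linarith

end Measure

section MainProperty

variable {Λ : Type u} [Ring Λ] {Y : Type v} [AddCommGroup Y] [Module Λ Y]

/-- Gabriel's main property for `N`, for embeddings into a direct sum of two modules. -/
def HasMainProperty (N : Submodule Λ Y) : Prop :=
  ∀ (A B : Type v) [AddCommGroup A] [AddCommGroup B] [Module Λ A] [Module Λ B]
    (f : Y →ₗ[Λ] A) (g : Y →ₗ[Λ] B), N ⊓ LinearMap.ker f ⊓ LinearMap.ker g = ⊥ →
      N ⊓ LinearMap.ker f = ⊥ ∨ N ⊓ LinearMap.ker g = ⊥ ∨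
        mu Λ N < max (mu Λ (map f N)) (mu Λ (map g N))

lemma ker_mkQ_comp {A : Type v} [AddCommGroup A] [Module Λ A] (f : Y →ₗ[Λ] A)
    (P : Submodule Λ A) : LinearMap.ker (P.mkQ.comp f) = comap f P := by
  rw [LinearMap.ker_comp, ker_mkQ]

lemma map_mkQ_sup_right {A : Type v} [AddCommGroup A] [Module Λ A] (P Q : Submodule Λ A) :
    map Q.mkQ (P ⊔ Q) = map Q.mkQ P := by
  rw [Submodule.map_sup, mkQ_map_self, sup_bot_eq]

lemma mu_ne_mu_map {N K : Submodule Λ Y} (hN : IsFiniteLength Λ N) (hi : IndecSub Λ N)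
    (hKN : K < N) (hK : IndecSub Λ K) (hmain : HasMainProperty K)
    (A : Type v) [AddCommGroup A] [Module Λ A] (f : Y →ₗ[Λ] A)
    (hf : K ⊓ LinearMap.ker f = ⊥) : mu Λ K ≠ mu Λ (map f N) := by
  induction hn : subLen Λ (map f N) using Nat.strong_induction_on generalizing A with
  | _ n ih =>
  subst hn
  intro he
  have hfN := isFiniteLength_map f hN
  by_cases hfi : IndecSub Λ (map f N)
  · have hmap : map f K = map f N := by
      by_contra hne
      have := mu_lt_of_lt (lt_of_le_of_ne (map_mono hKN.le) hne) hfN hfi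
      rw [mu_map hf] at this
      exact this.ne he
    have hle : N ≤ K ⊔ LinearMap.ker f := by
      rw [← Submodule.comap_map_eq, hmap]
      exact le_comap_map f N
    have hsup : K ⊔ (N ⊓ LinearMap.ker f) = N := by
      rw [inf_comm, ← sup_inf_assoc_of_le _ hKN.le]
      exact inf_eq_right.mpr hle
    rcases hi.2 K (N ⊓ LinearMap.ker f) hKN.le inf_le_left hsup
      (by rw [← inf_assoc, inf_eq_left.mpr hKN.le, hf]) with h | h
    · exact hK.1 h
    · rw [h, sup_bot_eq] at hsup
      exact hKN.ne hsup
  · have hf0 : map f N ≠ ⊥ := fun h0 => by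
      rw [h0, mu_bot] at he
      exact (mu_pos (isFiniteLength_of_le hKN.le hN) hK.1).ne' he
    obtain ⟨P, Q, hP, hQ, hs, hpq⟩ := exists_decomposition hf0 hfi
    have key : ∀ P Q : Submodule Λ A, P < map f N → P ⊔ Q = map f N → P ⊓ Q = ⊥ →
        map (Q.mkQ.comp f) N = map Q.mkQ P ∧ mu Λ (map Q.mkQ P) = mu Λ P ∧
        subLen Λ (map Q.mkQ P) = subLen Λ P := by
      intro P Q _ hs hpq
      have hk : P ⊓ LinearMap.ker Q.mkQ = ⊥ := by rwa [ker_mkQ]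
      refine ⟨?_, mu_map hk, (subLen_congr (equivMap _ hk)).symm⟩
      rw [Submodule.map_comp, ← hs, map_mkQ_sup_right]
    have key2 : ∀ P Q : Submodule Λ A, P < map f N → P ⊔ Q = map f N → P ⊓ Q = ⊥ →
        K ⊓ LinearMap.ker (Q.mkQ.comp f) ≠ ⊥ := by
      intro P Q hP hs hpq h0
      obtain ⟨h1, h2, h3⟩ := key P Q hP hs hpq
      refine ih _ ?_ (A ⧸ Q) (Q.mkQ.comp f) h0 rfl (le_antisymm ?_ ?_)
      · rw [h1, h3]
        exact subLen_lt hP hfN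
      · rw [← mu_map h0]
        exact mu_mono (map_mono hKN.le) (isFiniteLength_map _ hN)
      · rw [h1, h2, he]
        exact mu_mono hP.le hfN
    rcases hmain _ _ (Q.mkQ.comp f) (P.mkQ.comp f) (by
      rw [ker_mkQ_comp, ker_mkQ_comp, inf_assoc, ← comap_inf, inf_comm Q P, hpq]
      exact hf) with h | h | h
    · exact key2 P Q hP hs hpq h
    · exact key2 Q P hQ (by rw [sup_comm, hs]) (by rw [inf_comm, hpq]) h
    · refine absurd h (not_lt.mpr (max_le ?_ ?_))
      · refine (mu_mono (map_mono hKN.le) (isFiniteLength_map _ hN)).trans ?_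
        obtain ⟨h1, h2, h3⟩ := key P Q hP hs hpq
        rw [h1, h2, he]
        exact mu_mono hP.le hfN
      · refine (mu_mono (map_mono hKN.le) (isFiniteLength_map _ hN)).trans ?_
        obtain ⟨h1, h2, h3⟩ := key Q P hQ (by rw [sup_comm, hs]) (by rw [inf_comm, hpq])
        rw [h1, h2, he]
        exact mu_mono hQ.le hfN

theorem hasMainProperty {N : Submodule Λ Y} (hN : IsFiniteLength Λ N) (hi : IndecSub Λ N) :
    HasMainProperty N := by
  induction hn : subLen Λ N using Nat.strong_induction_on generalizing N with
  | _ n ih =>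
  subst hn
  intro A B _ _ _ _ f g hfg
  by_contra! hcon
  obtain ⟨hf, hg, hle⟩ := hcon
  obtain ⟨K, hKN, hK, hmu⟩ := exists_gr_sub hN hi
  have hKf := isFiniteLength_of_le hKN.le hN
  have lt_of_ker : ∀ {C : Type v} [AddCommGroup C] [Module Λ C] (h : Y →ₗ[Λ] C),
      N ⊓ LinearMap.ker h ≠ ⊥ → subLen Λ (map h N) < subLen Λ N := by
    intro C _ _ h h0
    have h1 := subLen_lt (bot_lt_iff_ne_bot.mpr h0) (isFiniteLength_of_le inf_le_left hN)
    rw [subLen_bot] at h1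
    have := subLen_eq_inf_ker_add_map h hN
    omega
  have hlt : mu Λ K < max (mu Λ (map f N)) (mu Λ (map g N)) := by
    rcases hK with rfl | hK
    · rw [mu_bot, lt_max_iff]
      by_cases h0 : map f N = ⊥
      · right
        refine mu_pos (isFiniteLength_map g hN) fun h1 => hi.1 ?_
        rw [← le_bot_iff, ← hfg]
        rw [← le_bot_iff, map_le_iff_le_comap] at h0 h1
        exact le_inf (le_inf le_rfl h0) h1
      · exact Or.inl (mu_pos (isFiniteLength_map f hN) h0)
    · have hm := ih _ (subLen_lt hKN hN) hKf hK rfl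
      have hfK := mu_mono (map_mono hKN.le) (isFiniteLength_map f hN)
      have hgK := mu_mono (map_mono hKN.le) (isFiniteLength_map g hN)
      rcases hm A B f g (le_bot_iff.mp
        ((inf_le_inf_right _ (inf_le_inf_right _ hKN.le)).trans hfg.le)) with h | h | h
      · refine lt_max_of_lt_left (lt_of_le_of_ne ?_ (mu_ne_mu_map hN hi hKN hK hm A f h))
        rwa [← mu_map h]
      · refine lt_max_of_lt_right (lt_of_le_of_ne ?_ (mu_ne_mu_map hN hi hKN hK hm B g h))
        rwa [← mu_map h]
      · exact h.trans_le (max_le_max hfK hgK)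
  have hKl := subLen_lt hKN hN
  refine absurd hle (not_le.mpr ?_)
  rw [hmu]
  rcases lt_max_iff.mp hlt with h | h
  · exact lt_max_of_lt_left
      (mu_add_lt hKf (isFiniteLength_map f hN) h hKl (lt_of_ker f hf))
  · exact lt_max_of_lt_right
      (mu_add_lt hKf (isFiniteLength_map g hN) h hKl (lt_of_ker g hg))

end MainProperty

section Tube

variable {Λ : Type u} [Ring Λ] {Z : Type v} [AddCommGroup Z] [Module Λ Z]

/-- The quotient `N / (K ∩ N)` as a submodule of the quotient of the ambient module by `K`. -/
noncomputable def quotEquivMap (N K : Submodule Λ Z) :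
    (N ⧸ comap N.subtype K) ≃ₗ[Λ] map K.mkQ N :=
  (quotEquivOfEq _ _ (by rw [ker_mkQ_comp])).trans <|
    (LinearMap.quotKerEquivRange (K.mkQ.comp N.subtype)).trans <|
      LinearEquiv.ofEq _ _ (by rw [LinearMap.range_comp, range_subtype])

/-- The chain `0 = C 0 ⊂ C 1 ⊂ C 2 ⊂ ⋯` of indecomposable modules in a homogeneous tube whose
boundary module `C 1` is a brick. -/
structure IsBrickTube (C : ℕ → Submodule Λ Z) : Prop where
  bot : C 0 = ⊥
  lt : ∀ n : ℕ, C n < C (n + 1)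
  finiteLength : ∀ n : ℕ, 1 ≤ n → IsFiniteLength Λ (C n)
  indec : ∀ n : ℕ, 1 ≤ n → IndecSub Λ (C n)
  irr : ∀ n : ℕ, 1 ≤ n → IsIrreducibleHom Λ (Submodule.inclusion (lt n).le)
  quot : ∀ n : ℕ, Nonempty
      ((↥(C (n + 1)) ⧸ Submodule.comap (C (n + 1)).subtype (C n)) ≃ₗ[Λ] ↥(C 1))
  indec_quot : ∀ n : ℕ, 2 ≤ n →
      IndecMod Λ (↥(C n) ⧸ Submodule.comap (C n).subtype (C (n - 2)))
  brick : IsBrick Λ ↥(C 1)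

namespace IsBrickTube

variable {C : ℕ → Submodule Λ Z} (hC : IsBrickTube C)
include hC

lemma strictMono : StrictMono C := strictMono_nat_of_lt_succ hC.lt

lemma isFiniteLength (n : ℕ) : IsFiniteLength Λ (C n) := by
  rcases n.eq_zero_or_pos with rfl | hn
  · exact isFiniteLength_of_le (hC.lt 0).le (hC.finiteLength 1 le_rfl)
  · exact hC.finiteLength n hn

lemma exists_equiv_map (n : ℕ) : Nonempty (map (C n).mkQ (C (n + 1)) ≃ₗ[Λ] C 1) :=
  (hC.quot n).map fun e => (quotEquivMap _ _).symm.trans e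

lemma subLen_eq (n : ℕ) : subLen Λ (C n) = n * subLen Λ (C 1) := by
  induction n with
  | zero => rw [hC.bot, subLen_bot, zero_mul]
  | succ n ih =>
    obtain ⟨e⟩ := hC.exists_equiv_map n
    rw [subLen_eq_inf_ker_add_map (C n).mkQ (hC.isFiniteLength _), ker_mkQ,
      inf_eq_right.mpr (hC.lt n).le, subLen_congr e, ih, add_mul, one_mul]

lemma subLen_pos : 0 < subLen Λ (C 1) := by
  have := subLen_lt (hC.lt 0) (hC.isFiniteLength 1)
  exact (Nat.zero_le _).trans_lt this

lemma eq_or_eq_of_sup_eq_of_inf_eq {m : ℕ} {P Q : Submodule Λ Z} (hs : P ⊔ Q = C (m + 2))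
    (hi : P ⊓ Q = C m) : P = C m ∨ Q = C m := by
  have hind : IndecSub Λ (map (C m).mkQ (C (m + 2))) :=
    (indecSub_congr (Submodule.topEquiv.trans (quotEquivMap (C (m + 2)) (C m)))).mp
      (hC.indec_quot (m + 2) (by omega))
  have hP : C m ≤ P := hi ▸ inf_le_left
  have hQ : C m ≤ Q := hi ▸ inf_le_right
  have hb : ∀ {R : Submodule Λ Z}, C m ≤ R → map (C m).mkQ R = ⊥ → R = C m := by
    intro R hR h
    refine le_antisymm ?_ hR
    rwa [← le_bot_iff, map_le_iff_le_comap, ← LinearMap.ker, ker_mkQ] at h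
  refine (hind.2 (map (C m).mkQ P) (map (C m).mkQ Q) (map_mono (hs ▸ le_sup_left))
    (map_mono (hs ▸ le_sup_right)) (by rw [← Submodule.map_sup, hs]) ?_).imp (hb hP) (hb hQ)
  rw [← le_bot_iff]
  rintro _ ⟨⟨p, hp, rfl⟩, ⟨q, hq, hpq⟩⟩
  have hp' : p ∈ C m := by
    rw [← hi]
    refine ⟨hp, ?_⟩
    rw [mkQ_apply, mkQ_apply, Submodule.Quotient.eq] at hpq
    have := Q.sub_mem hq (hQ hpq)
    rwa [sub_sub_cancel] at this
  simpa using hp'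

lemma not_inf_le_of_sup_eq {m : ℕ} {V : Submodule Λ Z} (hs : V ⊔ C (m + 1) = C (m + 2))
    (hi : V ⊓ C (m + 1) ≤ C m) : False := by
  have hm := (hC.lt m).le
  rcases hC.eq_or_eq_of_sup_eq_of_inf_eq (m := m) (P := C (m + 1)) (Q := V ⊔ C m)
    (by rw [sup_comm, sup_assoc, sup_eq_right.mpr hm, hs])
    (by rw [inf_comm, sup_comm, sup_inf_assoc_of_le _ hm, sup_eq_left.mpr hi]) with h | h
  · exact (hC.lt m).ne' h
  · have hV : V ≤ C (m + 1) := le_sup_left.trans (h.le.trans hm)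
    rw [sup_eq_right.mpr hV] at hs
    exact (hC.lt (m + 1)).ne hs

/-- The lattice form of irreducibility of `C n ⊂ C (n + 1)`. -/
lemma exists_complement {n : ℕ} (hn : 1 ≤ n) {B : Submodule Λ Z} (hAB : C n ≤ B)
    (hB : B < C (n + 1)) : ∃ W, C n ⊓ W = ⊥ ∧ C n ⊔ W = B := by
  rcases (hC.irr n hn).2.2 B (isFiniteLength_of_le hB.le (hC.isFiniteLength _))
    (Submodule.inclusion hAB) (Submodule.inclusion hB.le) rfl with ⟨g, hg⟩ | ⟨g, hg⟩
  · have hg' : ∀ x (hx : x ∈ C n), g ⟨x, hAB hx⟩ = ⟨x, hx⟩ := fun x hx =>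
      LinearMap.congr_fun hg ⟨x, hx⟩
    refine ⟨map B.subtype (LinearMap.ker g), ?_, le_antisymm ?_ ?_⟩
    · rw [eq_bot_iff]
      rintro _ ⟨hx, ⟨y, hy⟩, hy0, rfl⟩
      have := hg' y hx
      rw [show g ⟨y, hy⟩ = 0 from hy0] at this
      simpa using (congrArg Subtype.val this).symm
    · exact sup_le hAB (map_subtype_le _ _)
    · intro x hx
      have h2 : x - (g ⟨x, hx⟩ : Z) ∈ map B.subtype (LinearMap.ker g) := by
        refine ⟨⟨x, hx⟩ - ⟨g ⟨x, hx⟩, hAB (g ⟨x, hx⟩).2⟩, ?_, rfl⟩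
        simp [hg']
      have := Submodule.add_mem_sup (g ⟨x, hx⟩).2 h2
      rwa [add_sub_cancel] at this
  · exfalso
    refine hB.not_ge fun x hx => ?_
    have := congrArg Subtype.val (LinearMap.congr_fun hg ⟨x, hx⟩)
    have h2 : ((g ⟨x, hx⟩ : B) : Z) = x := this
    exact h2 ▸ (g ⟨x, hx⟩).2

/-- `C (m + 1)` maps onto `C 1` with kernel `C m`. -/
lemma exists_hom (m : ℕ) : ∃ p : C (m + 1) →ₗ[Λ] C 1, Function.Surjective p ∧
    ∀ x, p x = 0 ↔ (x : Z) ∈ C m := by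
  obtain ⟨e⟩ := hC.quot m
  refine ⟨e.toLinearMap.comp (mkQ _), e.surjective.comp (mkQ_surjective _), fun x => ?_⟩
  simp


lemma map_mem_of_mem {n r : ℕ} {φ : C r →ₗ[Λ] Z} (hφ : ∀ x, φ x ∈ C n) {i : ℕ} (hi : i ≤ r)
    (x : C r) (hx : (x : Z) ∈ C i) : φ x ∈ C i := by
  induction i generalizing x with
  | zero =>
    rw [hC.bot, Submodule.mem_bot] at hx ⊢
    have hx0 : x = 0 := Subtype.ext hx
    rw [hx0, map_zero]
  | succ i ih =>
    have descend : ∀ d, (∀ x : C r, (x : Z) ∈ C (i + 1) → φ x ∈ C (i + d + 2)) →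
        ∀ x : C r, (x : Z) ∈ C (i + 1) → φ x ∈ C (i + d + 1) := by
      intro d hd
      obtain ⟨p, hp, hp0⟩ := hC.exists_hom i
      obtain ⟨q, hq, hq0⟩ := hC.exists_hom (i + d + 1)
      have hle := hC.strictMono.monotone hi
      let ψ : C (i + 1) →ₗ[Λ] C (i + d + 2) := (φ.comp (Submodule.inclusion hle)).codRestrict _
        fun x => hd _ x.2
      let f : C 1 →ₗ[Λ] C 1 := ((LinearMap.ker p).liftQ (q.comp ψ) (fun x hx => by
        rw [LinearMap.mem_ker, hp0] at hx
        rw [LinearMap.mem_ker, LinearMap.comp_apply, hq0]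
        exact hC.strictMono.monotone (by omega) (ih (by omega) _ hx))).comp
          (p.quotKerEquivOfSurjective hp).symm.toLinearMap
      have hf : ∀ x, f (p x) = q (ψ x) := by
        intro x
        have : (p.quotKerEquivOfSurjective hp).symm (p x) = (LinearMap.ker p).mkQ x := by
          rw [LinearEquiv.symm_apply_eq]
          rfl
        simp only [f, LinearMap.comp_apply, LinearEquiv.coe_coe, this]
        simp
      by_cases hf0 : f = 0
      · intro x hx
        have := hf ⟨x, hx⟩
        rw [hf0, LinearMap.zero_apply] at this
        exact (hq0 _).mp this.symm
      · have hbij := hC.brick.2 f hf0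
        refine (hC.not_inf_le_of_sup_eq (m := i + d)
          (V := map φ (comap (C r).subtype (C (i + 1)))) (le_antisymm ?_ ?_) ?_).elim
        · refine sup_le ?_ (hC.lt _).le
          rintro _ ⟨x, hx, rfl⟩
          exact hd x hx
        · intro y hy
          obtain ⟨z, hz⟩ := hbij.2 (q ⟨y, hy⟩)
          obtain ⟨x, rfl⟩ := hp z
          rw [hf] at hz
          have h1 : q (⟨y, hy⟩ - ψ x) = 0 := by rw [map_sub, hz, sub_self]
          rw [hq0] at h1
          have h2 : (ψ x : Z) ∈ map φ (comap (C r).subtype (C (i + 1))) :=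
            ⟨⟨x, hle x.2⟩, x.2, rfl⟩
          have := Submodule.add_mem_sup h2 h1
          simpa using this
        · rintro _ ⟨⟨x, hx, rfl⟩, hx'⟩
          have h1 : q (ψ ⟨x, hx⟩) = 0 := (hq0 _).mpr hx'
          rw [← hf, ← map_zero f, hbij.1.eq_iff, hp0] at h1
          exact hC.strictMono.monotone (by omega) (ih (by omega) x h1)
    have all : ∀ d, (∀ x : C r, (x : Z) ∈ C (i + 1) → φ x ∈ C (i + d + 1)) →
        ∀ x : C r, (x : Z) ∈ C (i + 1) → φ x ∈ C (i + 1) := by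
      intro d
      induction d with
      | zero => exact id
      | succ d ihd => exact fun h => ihd (descend d h)
    exact all n (fun x _ => hC.strictMono.monotone (by omega) (hφ x)) x hx

lemma eq_of_equiv {n r : ℕ} {V : Submodule Λ Z} (hV : V ≤ C n) (e : C r ≃ₗ[Λ] V) : V = C r := by
  refine eq_of_subLen_le ?_ (hC.isFiniteLength r) (subLen_congr e).le
  intro v hv
  have := hC.map_mem_of_mem (φ := V.subtype.comp e.toLinearMap) (fun x => hV (e x).2) le_rfl
    (e.symm ⟨v, hv⟩) (e.symm ⟨v, hv⟩).2
  simpa using this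

lemma mu_strictMono : StrictMono fun n => mu Λ (C n) :=
  strictMono_nat_of_lt_succ fun n =>
    mu_lt_of_lt (hC.lt n) (hC.isFiniteLength _) (hC.indec _ (by omega))

/-- Submodules `U` not supplementing `C n` in `C (n + 1)`. -/
lemma mu_le_of_sup_ne {n r : ℕ} (hn : 1 ≤ n) (hr : 1 ≤ r)
    (ih : ∀ U ≤ C n, IndecSub Λ U → subLen Λ U < (r + 1) * subLen Λ (C 1) →
      mu Λ U ≤ mu Λ (C r) ∧ (mu Λ U = mu Λ (C r) → U = C r))
    {U : Submodule Λ Z} (hU : U ≤ C (n + 1)) (hi : IndecSub Λ U)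
    (hl : subLen Λ U < (r + 1) * subLen Λ (C 1)) (hsup : U ⊔ C n ≠ C (n + 1)) :
    mu Λ U ≤ mu Λ (C r) ∧ (mu Λ U = mu Λ (C r) → U = C r) := by
  have hUf := isFiniteLength_of_le hU (hC.isFiniteLength _)
  have hr0 := mu_nonneg (hC.isFiniteLength r)
  have hlt : U ⊔ C n < C (n + 1) := lt_of_le_of_ne (sup_le hU (hC.lt n).le) hsup
  obtain ⟨W, hW0, hW⟩ := hC.exists_complement hn le_sup_right hlt
  have hg : mu Λ (map (C n).mkQ U) < mu Λ (C r) := by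
    obtain ⟨e⟩ := hC.exists_equiv_map n
    have hlt' : map (C n).mkQ U < map (C n).mkQ (C (n + 1)) := by
      refine lt_of_le_of_ne (map_mono hU) fun h => hsup (le_antisymm hlt.le ?_)
      intro x hx
      obtain ⟨y, hy, hyx⟩ := h.ge (mem_map_of_mem hx)
      rw [mkQ_apply, mkQ_apply, Submodule.Quotient.eq] at hyx
      have := Submodule.add_mem_sup hy ((C n).neg_mem hyx)
      simpa using this
    refine (mu_lt_of_lt hlt' (isFiniteLength_map _ (hC.isFiniteLength _))
      ((indecSub_congr e).mpr (hC.indec 1 le_rfl))).trans_le ?_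
    rw [mu_congr e]
    exact hC.mu_strictMono.monotone hr
  set P := C n ⊓ (U ⊔ W) with hP
  have hPC : P ≤ C n := inf_le_left
  have hPf := isFiniteLength_of_le hPC (hC.isFiniteLength n)
  have hmap : map W.mkQ P = map W.mkQ U := by
    have hPW : P ⊔ W = U ⊔ W := by
      rw [hP, inf_comm, inf_sup_assoc_of_le _ le_sup_right, hW, inf_eq_left]
      exact sup_le le_sup_left (le_sup_right.trans hW.le)
    rw [← map_mkQ_sup_right, hPW, map_mkQ_sup_right]
  have hPk : P ⊓ LinearMap.ker W.mkQ = ⊥ := by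
    rw [ker_mkQ, ← le_bot_iff, ← hW0]
    exact inf_le_inf_right _ hPC
  have hPmu : mu Λ P = mu Λ (map W.mkQ U) := by rw [← hmap, mu_map hPk]
  have hPl : subLen Λ P ≤ subLen Λ U := by
    rw [subLen_congr (equivMap _ hPk), hmap, subLen_eq_inf_ker_add_map W.mkQ hUf]
    omega
  have hPle : mu Λ P ≤ mu Λ (C r) := mu_le_of_forall_indecSub hPf hr0 fun V hV hVi =>
    (ih V (hV.trans hPC) hVi (((subLen_mono hV hPf).trans hPl).trans_lt hl)).1
  rcases hasMainProperty hUf hi _ _ W.mkQ (C n).mkQ (by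
    rw [ker_mkQ, ker_mkQ, inf_assoc, inf_comm W, hW0, inf_bot_eq]) with h | h | h
  · have e : U ≃ₗ[Λ] P := (equivMap _ h).trans
      ((LinearEquiv.ofEq _ _ hmap.symm).trans (equivMap _ hPk).symm)
    have := ih P hPC ((indecSub_congr e).mp hi) (hPl.trans_lt hl)
    rw [mu_congr e]
    refine ⟨this.1, fun h2 => hC.eq_of_equiv hU ?_⟩
    exact (LinearEquiv.ofEq _ _ (this.2 h2).symm).trans e.symm
  · rw [← mu_map h]
    exact ⟨hg.le, fun h2 => absurd h2 hg.ne⟩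
  · have := h.trans_le (max_le (hPmu ▸ hPle) hg.le)
    exact ⟨this.le, fun h2 => absurd h2 this.ne⟩

/-- Proper submodules `U` supplementing `C (n + 1)` in `C (n + 2)`. -/
lemma mu_lt_of_sup_eq {n r : ℕ} (hrn : r ≤ n + 1) {U : Submodule Λ Z}
    (hUf : IsFiniteLength Λ U)
    (ih : ∀ j, 1 ≤ j → ∀ K < U, IndecSub Λ K → subLen Λ K < (j + 1) * subLen Λ (C 1) →
      mu Λ K ≤ mu Λ (C j) ∧ (mu Λ K = mu Λ (C j) → K = C j))
    (hi : IndecSub Λ U) (hl : subLen Λ U < (r + 1) * subLen Λ (C 1))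
    (hsup : U ⊔ C (n + 1) = C (n + 2)) : mu Λ U < mu Λ (C r) := by
  have hs := hC.subLen_pos
  set s := subLen Λ (C 1) with hs_def
  have hlen : subLen Λ U = subLen Λ (U ⊓ C (n + 1)) + s := by
    obtain ⟨e⟩ := hC.exists_equiv_map (n + 1)
    rw [subLen_eq_inf_ker_add_map (C (n + 1)).mkQ hUf, ker_mkQ, ← map_mkQ_sup_right U, hsup,
      subLen_congr e]
  have hUC : ¬ U ⊓ C (n + 1) ≤ C n := fun h => hC.not_inf_le_of_sup_eq hsup h
  have hIf := isFiniteLength_of_le (inf_le_left : U ⊓ C (n + 1) ≤ U) hUf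
  have hpos : 0 < subLen Λ (U ⊓ C (n + 1)) := by
    have hne : U ⊓ C (n + 1) ≠ ⊥ := fun h => hUC (h ▸ bot_le)
    exact (Nat.zero_le _).trans_lt (subLen_lt (bot_lt_iff_ne_bot.mpr hne) hIf)
  obtain ⟨j, hj1, hj2⟩ : ∃ j, j * s < subLen Λ U ∧ subLen Λ U ≤ (j + 1) * s := by
    refine ⟨(subLen Λ U - 1) / s, ?_, ?_⟩
    · have := Nat.div_mul_le_self (subLen Λ U - 1) s
      omega
    · have := Nat.lt_mul_div_succ (subLen Λ U - 1) hs
      rw [mul_comm] at this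
      omega
  have hj : 1 ≤ j := by
    rcases j.eq_zero_or_pos with rfl | h
    · omega
    · exact h
  have hjr : j ≤ r := by
    have := lt_of_mul_lt_mul_right (hj1.trans hl) s.zero_le
    omega
  obtain ⟨K, hKU, hK, hmu⟩ := exists_gr_sub hUf hi
  have hKf := isFiniteLength_of_le hKU.le hUf
  have hCj := hC.isFiniteLength j
  have hlt : mu Λ K < mu Λ (C j) := by
    rcases hK with rfl | hK
    · rw [mu_bot]
      exact mu_pos hCj (hC.indec j hj).1
    · have hKl := subLen_lt hKU hUf
      obtain ⟨h1, h2⟩ := ih j hj K hKU hK (hKl.trans_le hj2)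
      refine lt_of_le_of_ne h1 fun h => ?_
      have hKj := h2 h
      have hle : C j ≤ U ⊓ C (n + 1) :=
        le_inf (hKj ▸ hKU.le) (hC.strictMono.monotone (hjr.trans hrn))
      have hCl := hC.subLen_eq j
      have heq := eq_of_subLen_le hle hIf (by rw [hCl, ← hs_def]; linarith)
      rw [← heq, hCl, ← hs_def] at hlen
      refine hUC (heq ▸ hC.strictMono.monotone ?_)
      have : j + 1 < r + 1 := lt_of_mul_lt_mul_right (a := s) (by linarith) s.zero_le
      omega
  rw [hmu]
  refine (mu_add_lt hKf hCj hlt (subLen_lt hKU hUf) ?_).trans_le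
    (hC.mu_strictMono.monotone hjr)
  rw [hC.subLen_eq]
  exact hj1

theorem mu_le_of_subLen_lt (n : ℕ) {r : ℕ} (hr : 1 ≤ r) {U : Submodule Λ Z} (hU : U ≤ C n)
    (hi : IndecSub Λ U) (hl : subLen Λ U < (r + 1) * subLen Λ (C 1)) :
    mu Λ U ≤ mu Λ (C r) ∧ (mu Λ U = mu Λ (C r) → U = C r) := by
  induction n generalizing r U with
  | zero => exact absurd (le_bot_iff.mp (hU.trans hC.bot.le)) hi.1
  | succ n ihn =>
    induction hm : subLen Λ U using Nat.strong_induction_on generalizing r U with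
    | _ m ihm =>
    subst hm
    have hfin := hC.isFiniteLength (n + 1)
    rcases le_or_gt (n + 1) r with hnr | hnr
    · have h1 := mu_mono hU hfin
      have h2 := hC.mu_strictMono.monotone hnr
      refine ⟨h1.trans h2, fun h => ?_⟩
      have hUe : U = C (n + 1) := by
        by_contra hne
        exact ((mu_lt_of_lt (lt_of_le_of_ne hU hne) hfin (hC.indec _ (by omega))).trans_le
          h2).ne h
      rw [hUe, hC.mu_strictMono.injective (h2.antisymm (by rw [← h]; exact h1))]
    · by_cases hsup : U ⊔ C n = C (n + 1)
      · obtain ⟨n, rfl⟩ : ∃ n', n = n' + 1 := ⟨n - 1, by omega⟩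
        have := hC.mu_lt_of_sup_eq (by omega) (isFiniteLength_of_le hU hfin)
          (fun j hj K hK hKi hKl => ihm _ (subLen_lt hK (isFiniteLength_of_le hU hfin)) hj
            (hK.le.trans hU) hKi hKl rfl) hi hl hsup
        exact ⟨this.le, fun h => absurd h this.ne⟩
      · exact hC.mu_le_of_sup_ne (by omega) hr (fun V hV hVi hVl => ihn hr hV hVi hVl)
          hU hi hl hsup

lemma mu_succ {n : ℕ} (hn : 1 ≤ n) :
    mu Λ (C (n + 1)) = mu Λ (C n) + (2 : ℝ) ^ (-(((n + 1) * subLen Λ (C 1) : ℕ) : ℤ)) := by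
  have hf := hC.isFiniteLength (n + 1)
  have hi := hC.indec (n + 1) (by omega)
  have hl := hC.subLen_eq (n + 1)
  refine le_antisymm ?_ (hl ▸ mu_add_le_of_lt (hC.lt n) hf hi)
  obtain ⟨K, hK, hKi, hmu⟩ := exists_gr_sub hf hi
  rw [hmu, hl]
  gcongr
  rcases hKi with rfl | hKi
  · rw [mu_bot]
    exact mu_nonneg (hC.isFiniteLength n)
  · exact (hC.mu_le_of_subLen_lt (n + 1) hn hK.le hKi (hl ▸ subLen_lt hK hf)).1

lemma mu_eq_sub (n : ℕ) :
    mu Λ (C (n + 1)) = mu Λ (C 1) - ((2 : ℝ) ^ subLen Λ (C 1))⁻¹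
      + 1 / ((2 : ℝ) ^ subLen Λ (C 1) - 1)
      - (((2 : ℝ) ^ subLen Λ (C 1))⁻¹) ^ (n + 1) / ((2 : ℝ) ^ subLen Λ (C 1) - 1) := by
  have h1 : (1 : ℝ) < 2 ^ subLen Λ (C 1) := one_lt_pow₀ one_lt_two hC.subLen_pos.ne'
  have h2 : (2 : ℝ) ^ subLen Λ (C 1) - 1 ≠ 0 := by linarith
  have h3 : (2 : ℝ) ^ subLen Λ (C 1) ≠ 0 := by linarith
  induction n with
  | zero =>
    simp only [zero_add, pow_one]
    field_simp
    ring
  | succ n ih =>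
    rw [hC.mu_succ (by omega), ih, zpow_neg, zpow_natCast, mul_comm, pow_mul]
    set x := (2 : ℝ) ^ subLen Λ (C 1)
    simp only [inv_pow]
    field_simp
    ring

lemma tendsto_mu : Filter.Tendsto (fun n => mu Λ (C (n + 1))) Filter.atTop
    (nhds (mu Λ (C 1) - ((2 : ℝ) ^ subLen Λ (C 1))⁻¹ + 1 / ((2 : ℝ) ^ subLen Λ (C 1) - 1))) := by
  have h1 : (1 : ℝ) < 2 ^ subLen Λ (C 1) := one_lt_pow₀ one_lt_two hC.subLen_pos.ne'
  have h2 := (((tendsto_pow_atTop_nhds_zero_of_lt_one (by positivity)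
    (inv_lt_one_of_one_lt₀ h1)).comp (Filter.tendsto_add_atTop_nat 1)).div_const
      ((2 : ℝ) ^ subLen Λ (C 1) - 1)).const_sub (mu Λ (C 1) - ((2 : ℝ) ^ subLen Λ (C 1))⁻¹
        + 1 / ((2 : ℝ) ^ subLen Λ (C 1) - 1))
  rw [zero_div, sub_zero] at h2
  exact h2.congr fun n => (hC.mu_eq_sub n).symm

lemma exists_le (hsup : iSup C = ⊤) {U : Submodule Λ Z} (hU : IsFiniteLength Λ U) :
    ∃ n, U ≤ C n := by
  have hfg : U.FG := by
    have := (isFiniteLength_iff_isNoetherian_isArtinian.mp hU).1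
    exact Module.Finite.iff_fg.mp inferInstance
  obtain ⟨_, ⟨n, rfl⟩, hn⟩ := (fg_iff_compact U).mp hfg (Set.range C) ⊤ (Set.range_nonempty C)
    hC.strictMono.monotone.directed_le.directedOn_range (hsup ▸ isLUB_iSup) le_top
  exact ⟨n, hn⟩

theorem sSup_mu_eq (hsup : iSup C = ⊤) :
    sSup {r : ℝ | ∃ U : Submodule Λ Z, IsFiniteLength Λ ↥U ∧ mu Λ U = r} =
      mu Λ (C 1) - ((2 : ℝ) ^ subLen Λ (C 1))⁻¹ + 1 / ((2 : ℝ) ^ subLen Λ (C 1) - 1) := by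
  have hmono : Monotone fun n => mu Λ (C (n + 1)) := fun a b hab =>
    hC.mu_strictMono.monotone (by omega)
  refine IsLUB.csSup_eq ⟨?_, ?_⟩ ⟨_, C 1, hC.isFiniteLength 1, rfl⟩
  · rintro _ ⟨U, hU, rfl⟩
    obtain ⟨n, hn⟩ := hC.exists_le hsup hU
    exact (mu_mono (hn.trans (hC.lt n).le) (hC.isFiniteLength _)).trans
      (hmono.ge_of_tendsto hC.tendsto_mu n)
  · intro b hb
    exact le_of_tendsto' hC.tendsto_mu fun n => hb ⟨_, hC.isFiniteLength _, rfl⟩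

end IsBrickTube

lemma mu_eq_add_of_isGRSub {N X : Submodule Λ Z} (hX : X ≤ N) (h : IsGRSub Λ (comap N.subtype X)) :
    mu Λ N = mu Λ X + ((2 : ℝ) ^ subLen Λ N)⁻¹ := by
  have h1 := h.2.2.2
  rwa [mu_congr (comapSubtypeEquivOfLe hX), mu_congr (Submodule.topEquiv (R := Λ) (M := N)),
    subLen_congr (Submodule.topEquiv (R := Λ) (M := N)), zpow_neg, zpow_natCast] at h1

end Tube

end GabrielRoiter

/-- Consider a homogeneous tube whose boundary module `M[1]` is a
brick: a chain `M[1] → M[2] → ⋯` of irreducible monomorphisms between indecomposable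
finite length modules with `M[m]/M[m−1] ≅ M[1]` for all `m` and `M[m]/M[m−2]`
indecomposable for `m ≥ 2` (with `M[0] = 0`). The Prüfer module `M[∞]`, the direct
limit of the chain, is realized as a module `Z` together with an exhaustive increasing
chain of submodules `C m = M[m]` (so `C 0 = ⊥` and `⨆ C = ⊤`). Defining the
Gabriel-Roiter measure of `M[∞]` as the supremum of the measures `μ(U)` over the finite
length submodules `U` of `Z`, this measure is a rational number; explicitly, it equals
`μ(X) + 1/(2^s − 1)` for any Gabriel-Roiter submodule `X` of `M[1]`, where
`s = |M[1]|`. -/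
theorem gabriel_roiter_stmt19
    (k : Type u) [CommRing k] [IsArtinianRing k]
    (Λ : Type u) [Ring Λ] [Algebra k Λ] [Module.Finite k Λ]
    (Z : Type v) [AddCommGroup Z] [Module Λ Z]
    (C : ℕ → Submodule Λ Z)
    (hbot : C 0 = ⊥)
    (hlt : ∀ n : ℕ, C n < C (n + 1))
    (hsup : iSup C = ⊤)
    (hfl : ∀ n : ℕ, 1 ≤ n → IsFiniteLength Λ (C n))
    (hindec : ∀ n : ℕ, 1 ≤ n → IndecSub Λ (C n))
    (hirr : ∀ n : ℕ, 1 ≤ n → IsIrreducibleHom Λ (Submodule.inclusion (hlt n).le))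
    (hquot : ∀ n : ℕ, Nonempty
      ((↥(C (n + 1)) ⧸ Submodule.comap (C (n + 1)).subtype (C n)) ≃ₗ[Λ] ↥(C 1)))
    (hindec2 : ∀ n : ℕ, 2 ≤ n →
      IndecMod Λ (↥(C n) ⧸ Submodule.comap (C n).subtype (C (n - 2))))
    (hbrick : IsBrick Λ ↥(C 1)) :
    (∃ q : ℚ,
      sSup {r : ℝ | ∃ U : Submodule Λ Z, IsFiniteLength Λ ↥U ∧ mu Λ U = r} = (q : ℝ)) ∧
    ∀ X : Submodule Λ Z, X ≤ C 1 → IsGRSub Λ (Submodule.comap (C 1).subtype X) →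
      sSup {r : ℝ | ∃ U : Submodule Λ Z, IsFiniteLength Λ ↥U ∧ mu Λ U = r}
        = mu Λ X + 1 / ((2 : ℝ) ^ (subLen Λ (C 1)) - 1) := by
  have hC : GabrielRoiter.IsBrickTube C := ⟨hbot, hlt, hfl, hindec, hirr, hquot, hindec2, hbrick⟩
  rw [hC.sSup_mu_eq hsup]
  refine ⟨?_, fun X hX hGR => ?_⟩
  · obtain ⟨z, -, hz⟩ := GabrielRoiter.exists_mu_eq (hfl 1 le_rfl)
    refine ⟨z / 2 ^ subLen Λ (C 1) - (2 ^ subLen Λ (C 1))⁻¹ + 1 / (2 ^ subLen Λ (C 1) - 1), ?_⟩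
    rw [hz]
    push_cast
    rfl
  · rw [GabrielRoiter.mu_eq_add_of_isGRSub hX hGR, add_sub_cancel_right]
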